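/- Let τ ∈ ℂ with Im τ > 0, let n ≥ 1, and let ε₁, ε₂, ε₃ : ℂ → Matrix n n ℂ be smooth doubly periodic maps (periodic with periods 1 and τ). Then c_β(⁅ε₁, ε₂⁆, ε₃) + c_β(⁅ε₂, ε₃⁆, ε₁) + c_β(⁅ε₃, ε₁⁆, ε₂) = 0. (The 2-cocycle identity for the cocycle c_β(ε₁, ε₂) = 2πi ∫_P β ∧ tr(ε₁ ∂̄ε₂) defining the central extension of the two-dimensional current algebra on the elliptic curve P.) -/

import Mathlib

open MeasureTheory

attribute [local instance] Matrix.linftyOpNormedAddCommGroup Matrix.linftyOpNormedRing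
  Matrix.linftyOpNormedAlgebra

/-- The `∂/∂z̄` derivative of a map `F : ℂ → gl(n,ℂ)`, via the real Fréchet
derivative: `∂̄F(z) = (1/2)·(DF(z)(1) + i·DF(z)(i))`. -/
noncomputable def dbar {n : ℕ} (F : ℂ → Matrix (Fin n) (Fin n) ℂ) (z : ℂ) :
    Matrix (Fin n) (Fin n) ℂ :=
  (1 / 2 : ℂ) • (fderiv ℝ F z 1 + Complex.I • fderiv ℝ F z Complex.I)

/-- The 2-cocycle `c_β(ε₁, ε₂) = 2πi ∫_P β ∧ tr(ε₁ ∂̄ε₂)` on the elliptic curve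
`P = ℂ/(ℤ + τℤ)`, written in the coordinates `z = x + yτ`, `0 ≤ x, y ≤ 1`:
`c_β(ε₁, ε₂) = ∫₀¹∫₀¹ tr(ε₁(x + yτ)·(∂̄ε₂)(x + yτ)) dx dy`. -/
noncomputable def cocycleBeta {n : ℕ} (τ : ℂ)
    (ε₁ ε₂ : ℂ → Matrix (Fin n) (Fin n) ℂ) : ℂ :=
  ∫ y in (0 : ℝ)..1, ∫ x in (0 : ℝ)..1,
    (ε₁ ((x : ℂ) + (y : ℂ) * τ) * dbar ε₂ ((x : ℂ) + (y : ℂ) * τ)).trace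

/-- The pointwise bracket `⁅ε₁, ε₂⁆(z) = ε₁(z)·ε₂(z) − ε₂(z)·ε₁(z)`. -/
noncomputable def bracket {n : ℕ} (ε₁ ε₂ : ℂ → Matrix (Fin n) (Fin n) ℂ) :
    ℂ → Matrix (Fin n) (Fin n) ℂ :=
  fun z => ε₁ z * ε₂ z - ε₂ z * ε₁ z

lemma aux_path (f : ℂ → ℂ) (hf : ContDiff ℝ (⊤ : ℕ∞) f) (a v : ℂ) (hp : f (a + v) = f a) :
    ∫ t in (0 : ℝ)..1, fderiv ℝ f (a + (t : ℂ) * v) v = 0 := by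
  have hd : ∀ t : ℝ, HasDerivAt (fun t : ℝ => f (a + (t : ℂ) * v))
      (fderiv ℝ f (a + (t : ℂ) * v) v) t := by
    intro t
    have h1 : HasDerivAt (fun t : ℝ => a + (t : ℂ) * v) v t := by
      have := ((Complex.ofRealCLM.hasDerivAt (x := t)).mul_const v).const_add a
      simpa using this
    exact ((hf.differentiable (by simp)) _).hasFDerivAt.comp_hasDerivAt t h1
  have hc : Continuous (fun t : ℝ => fderiv ℝ f (a + (t : ℂ) * v) v) := by
    have := hf.continuous_fderiv (by simp)
    fun_prop
  rw [intervalIntegral.integral_eq_sub_of_hasDerivAt (fun t _ => hd t)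
    (hc.intervalIntegrable _ _)]
  simp [hp]

lemma aux_swap (F : ℝ → ℝ → ℂ) (hF : Continuous (Function.uncurry F)) :
    ∫ y in (0 : ℝ)..1, ∫ x in (0 : ℝ)..1, F y x = ∫ x in (0 : ℝ)..1, ∫ y in (0 : ℝ)..1, F y x := by
  simp only [intervalIntegral.integral_of_le zero_le_one]
  apply integral_integral_swap
  rw [Measure.prod_restrict]
  exact (hF.continuousOn.integrableOn_compact (isCompact_Icc.prod isCompact_Icc)).mono_set
    (Set.prod_mono Set.Ioc_subset_Icc_self Set.Ioc_subset_Icc_self)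

lemma aux_f (τ : ℂ) (hτ : 0 < τ.im) (f : ℂ → ℂ) (hf : ContDiff ℝ (⊤ : ℕ∞) f)
    (hp : ∀ z, f (z + 1) = f z ∧ f (z + τ) = f z) :
    ∫ y in (0 : ℝ)..1, ∫ x in (0 : ℝ)..1, (1 / 2 : ℂ) *
      (fderiv ℝ f ((x : ℂ) + (y : ℂ) * τ) 1
        + Complex.I * fderiv ℝ f ((x : ℂ) + (y : ℂ) * τ) Complex.I) = 0 := by
  have hfc := hf.continuous_fderiv (by simp)
  have e1 : ∀ y : ℝ, ∫ x in (0 : ℝ)..1, fderiv ℝ f ((x : ℂ) + (y : ℂ) * τ) 1 = 0 := by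
    intro y
    have := aux_path f hf ((y : ℂ) * τ) 1 (hp _).1
    simpa [add_comm] using this
  have e2 : ∫ y in (0 : ℝ)..1, ∫ x in (0 : ℝ)..1, fderiv ℝ f ((x : ℂ) + (y : ℂ) * τ) τ = 0 := by
    rw [aux_swap (fun y x => fderiv ℝ f ((x : ℂ) + (y : ℂ) * τ) τ)]
    · simp [fun x : ℝ => aux_path f hf (x : ℂ) τ (hp _).2]
    · simp only [Function.uncurry_def]; fun_prop
  have hI : ∀ z, fderiv ℝ f z Complex.I
      = (1 / τ.im : ℂ) * (fderiv ℝ f z τ - τ.re * fderiv ℝ f z 1) := by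
    intro z
    have h : τ = τ.re • (1 : ℂ) + τ.im • Complex.I := by
      simp
    have h2 : fderiv ℝ f z τ = τ.re * fderiv ℝ f z 1 + τ.im * fderiv ℝ f z Complex.I := by
      conv_lhs => rw [h, map_add, map_smul, map_smul]
      simp
    have : (τ.im : ℂ) ≠ 0 := by exact_mod_cast hτ.ne'
    rw [h2]; field_simp; ring
  have key : ∀ y : ℝ, ∫ x in (0 : ℝ)..1, (1 / 2 : ℂ) *
      (fderiv ℝ f ((x : ℂ) + (y : ℂ) * τ) 1
        + Complex.I * fderiv ℝ f ((x : ℂ) + (y : ℂ) * τ) Complex.I)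
      = (1 / 2 * Complex.I * (1 / τ.im) : ℂ) *
        ∫ x in (0 : ℝ)..1, fderiv ℝ f ((x : ℂ) + (y : ℂ) * τ) τ := by
    intro y
    have : ∀ x : ℝ, (1 / 2 : ℂ) *
      (fderiv ℝ f ((x : ℂ) + (y : ℂ) * τ) 1
        + Complex.I * fderiv ℝ f ((x : ℂ) + (y : ℂ) * τ) Complex.I)
        = (1 / 2 * (1 - Complex.I * (1 / τ.im) * τ.re) : ℂ)
            * fderiv ℝ f ((x : ℂ) + (y : ℂ) * τ) 1
          + (1 / 2 * Complex.I * (1 / τ.im) : ℂ) * fderiv ℝ f ((x : ℂ) + (y : ℂ) * τ) τ := by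
      intro x; rw [hI]; ring
    simp_rw [this]
    rw [intervalIntegral.integral_add, intervalIntegral.integral_const_mul,
      intervalIntegral.integral_const_mul, e1]
    · simp
    · exact Continuous.intervalIntegrable (by fun_prop) _ _
    · exact Continuous.intervalIntegrable (by fun_prop) _ _
  simp_rw [key]
  rw [intervalIntegral.integral_const_mul, e2, mul_zero]

lemma aux_trace_deriv {n : ℕ} (a b c : ℂ → Matrix (Fin n) (Fin n) ℂ) (z v : ℂ)
    (ha : DifferentiableAt ℝ a z) (hb : DifferentiableAt ℝ b z) (hc : DifferentiableAt ℝ c z) :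
    fderiv ℝ (fun z => (bracket a b z * c z).trace) z v
      = (bracket a b z * fderiv ℝ c z v).trace + (bracket b c z * fderiv ℝ a z v).trace
        + (bracket c a z * fderiv ℝ b z v).trace := by
  have h := (((ha.hasFDerivAt.mul' hb.hasFDerivAt).sub
    (hb.hasFDerivAt.mul' ha.hasFDerivAt)).mul' hc.hasFDerivAt)
  have h2 := (LinearMap.toContinuousLinearMap
    (Matrix.traceLinearMap (Fin n) ℝ ℂ)).hasFDerivAt.comp z h
  have h3 : HasFDerivAt (fun z => (bracket a b z * c z).trace) _ z := h2
  rw [h3.fderiv]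
  change ((a z * b z - b z * a z) * fderiv ℝ c z v +
    ((a z * fderiv ℝ b z v + fderiv ℝ a z v * b z)
      - (b z * fderiv ℝ a z v + fderiv ℝ b z v * a z)) * c z).trace = _
  simp only [bracket, add_mul, sub_mul, Matrix.trace_add, Matrix.trace_sub]
  have t2 := Matrix.trace_mul_cycle (b z) (fderiv ℝ a z v) (c z)
  have t3 := Matrix.trace_mul_cycle (a z) (fderiv ℝ b z v) (c z)
  have t5 := Matrix.trace_mul_cycle (b z) (c z) (fderiv ℝ a z v)
  have t6 := Matrix.trace_mul_cycle (a z) (c z) (fderiv ℝ b z v)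
  linear_combination -t5 - t2 + t3 + t6

lemma aux_cont_dbar {n : ℕ} (a : ℂ → Matrix (Fin n) (Fin n) ℂ)
    (ha : ContDiff ℝ (⊤ : ℕ∞) a) : Continuous (dbar a) := by
  have := ha.continuous_fderiv (by simp)
  unfold dbar
  fun_prop

lemma aux_cont {n : ℕ} (τ : ℂ) (a b : ℂ → Matrix (Fin n) (Fin n) ℂ)
    (ha : Continuous a) (hb : ContDiff ℝ (⊤ : ℕ∞) b) :
    Continuous (fun p : ℝ × ℝ => (a ((p.2 : ℂ) + (p.1 : ℂ) * τ)
      * dbar b ((p.2 : ℂ) + (p.1 : ℂ) * τ)).trace) := by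
  have := aux_cont_dbar b hb
  apply Continuous.matrix_trace
  fun_prop

lemma aux_add (F G : ℝ × ℝ → ℂ) (hF : Continuous F) (hG : Continuous G) :
    (∫ y in (0 : ℝ)..1, ∫ x in (0 : ℝ)..1, F (y, x))
      + (∫ y in (0 : ℝ)..1, ∫ x in (0 : ℝ)..1, G (y, x))
      = ∫ y in (0 : ℝ)..1, ∫ x in (0 : ℝ)..1, (F (y, x) + G (y, x)) := by
  rw [← intervalIntegral.integral_add]
  · congr 1; ext y
    rw [intervalIntegral.integral_add]
    · exact Continuous.intervalIntegrable (by fun_prop) _ _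
    · exact Continuous.intervalIntegrable (by fun_prop) _ _
  · exact (intervalIntegral.continuous_parametric_intervalIntegral_of_continuous'
      (f := fun y x => F (y, x)) (by simpa [Function.uncurry_def] using hF) 0 1).intervalIntegrable _ _
  · exact (intervalIntegral.continuous_parametric_intervalIntegral_of_continuous'
      (f := fun y x => G (y, x)) (by simpa [Function.uncurry_def] using hG) 0 1).intervalIntegrable _ _

/-- The 2-cocycle identity for `c_β` on the two-dimensional current algebra of the
elliptic curve: for smooth doubly periodic `ε₁, ε₂, ε₃ : ℂ → gl(n,ℂ)`,
`c_β(⁅ε₁, ε₂⁆, ε₃) + c_β(⁅ε₂, ε₃⁆, ε₁) + c_β(⁅ε₃, ε₁⁆, ε₂) = 0`. -/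
theorem cocycleBeta_jacobi (τ : ℂ) (hτ : 0 < τ.im) (n : ℕ) (hn : 1 ≤ n)
    (ε₁ ε₂ ε₃ : ℂ → Matrix (Fin n) (Fin n) ℂ)
    (h₁ : ContDiff ℝ (⊤ : ℕ∞) ε₁) (h₂ : ContDiff ℝ (⊤ : ℕ∞) ε₂)
    (h₃ : ContDiff ℝ (⊤ : ℕ∞) ε₃)
    (hp₁ : ∀ z : ℂ, ε₁ (z + 1) = ε₁ z ∧ ε₁ (z + τ) = ε₁ z)
    (hp₂ : ∀ z : ℂ, ε₂ (z + 1) = ε₂ z ∧ ε₂ (z + τ) = ε₂ z)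
    (hp₃ : ∀ z : ℂ, ε₃ (z + 1) = ε₃ z ∧ ε₃ (z + τ) = ε₃ z) :
    cocycleBeta τ (bracket ε₁ ε₂) ε₃ + cocycleBeta τ (bracket ε₂ ε₃) ε₁
      + cocycleBeta τ (bracket ε₃ ε₁) ε₂ = 0 := by
  have d₁ := h₁.differentiable (by simp)
  have d₂ := h₂.differentiable (by simp)
  have d₃ := h₃.differentiable (by simp)
  have hb : ∀ a b : ℂ → Matrix (Fin n) (Fin n) ℂ, Continuous a → Continuous b →
      Continuous (bracket a b) := by
    intro a b ha hb
    unfold bracket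
    fun_prop
  have c12 := aux_cont τ _ _ (hb _ _ h₁.continuous h₂.continuous) h₃
  have c23 := aux_cont τ _ _ (hb _ _ h₂.continuous h₃.continuous) h₁
  have c31 := aux_cont τ _ _ (hb _ _ h₃.continuous h₁.continuous) h₂
  have hf : ContDiff ℝ (⊤ : ℕ∞) (fun z => (bracket ε₁ ε₂ z * ε₃ z).trace) :=
    (LinearMap.toContinuousLinearMap (Matrix.traceLinearMap (Fin n) ℝ ℂ)).contDiff.comp
      (((h₁.mul h₂).sub (h₂.mul h₁)).mul h₃)
  have main := aux_f τ hτ _ hf (by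
    intro z
    simp [bracket, hp₁ z, hp₂ z, hp₃ z])
  unfold cocycleBeta
  have s1 := aux_add _ _ c12 c23
  have s2 := aux_add _ _ (c12.add c23) c31
  simp only [] at s1 s2
  rw [s1]
  refine s2.trans (Eq.trans ?_ main)
  congr 1; ext y
  congr 1; ext x
  rw [aux_trace_deriv _ _ _ _ _ (d₁ _) (d₂ _) (d₃ _), aux_trace_deriv _ _ _ _ _ (d₁ _) (d₂ _) (d₃ _)]
  simp only [Pi.add_apply, dbar, Matrix.mul_smul, mul_add, Matrix.trace_smul, Matrix.trace_add, smul_eq_mul]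
  ring
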